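/- arXiv:2011.04162 — 5 statements merged into one kernel-verified Lean document; each statement's English description precedes it below -/
import Mathlib

section
/- Let X ⊆ ℝ^q be compact, γ > 0, c : X × X → ℝ continuous with 0 ≤ c(x,y) ≤ M_c for all x, y ∈ X, and let α, β be probability measures on X. Suppose f, g : X → ℝ are continuous and satisfy the Sinkhorn optimality (fixed point) equations g = A(f, α) and f = A(g, β), and that f(x₀) = 0 for some x₀ ∈ X. Then ‖f‖∞ ≤ 2M_c and ‖g‖∞ ≤ 2M_c. -/
open MeasureTheory

/-- The Sinkhorn mapping `A(f, α)(y) = -γ log ∫ exp((f x - c x y)/γ) dα(x)`. -/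
noncomputable def sinkhornMap {q : ℕ} (γ : ℝ)
    (c : EuclideanSpace ℝ (Fin q) → EuclideanSpace ℝ (Fin q) → ℝ)
    (f : EuclideanSpace ℝ (Fin q) → ℝ)
    (α : Measure (EuclideanSpace ℝ (Fin q))) :
    EuclideanSpace ℝ (Fin q) → ℝ :=
  fun y => -γ * Real.log (∫ x, Real.exp ((f x - c x y) / γ) ∂α)

/-- The soft minimum `-γ log ∫ exp(u / γ)` is antitone in `u`, up to additive constants. -/
lemma neg_mul_log_integral_exp_div_le {Ω : Type*} [MeasurableSpace Ω] {μ : Measure Ω} [NeZero μ]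
    {γ K : ℝ} (hγ : 0 < γ) {u v : Ω → ℝ}
    (hu : Integrable (fun x => Real.exp (u x / γ)) μ)
    (hv : Integrable (fun x => Real.exp (v x / γ)) μ)
    (huv : ∀ᵐ x ∂μ, u x ≤ v x + K) :
    -γ * Real.log (∫ x, Real.exp (v x / γ) ∂μ) ≤
      -γ * Real.log (∫ x, Real.exp (u x / γ) ∂μ) + K := by
  have hle : ∫ x, Real.exp (u x / γ) ∂μ ≤ Real.exp (K / γ) * ∫ x, Real.exp (v x / γ) ∂μ := by
    rw [← integral_const_mul]
    refine integral_mono_ae hu (hv.const_mul _) ?_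
    filter_upwards [huv] with x hx
    rw [← Real.exp_add, ← add_div, add_comm]
    gcongr
  have hlog := Real.log_le_log (integral_exp_pos hu) hle
  rw [Real.log_mul (Real.exp_pos _).ne' (integral_exp_pos hv).ne', Real.log_exp] at hlog
  have hmul := mul_le_mul_of_nonneg_left hlog hγ.le
  rw [mul_add, mul_div_cancel₀ K hγ.ne'] at hmul
  linarith

lemma neg_mul_log_integral_exp_const_div {Ω : Type*} [MeasurableSpace Ω] (μ : Measure Ω)
    [IsProbabilityMeasure μ] {γ : ℝ} (hγ : γ ≠ 0) (a : ℝ) :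
    -γ * Real.log (∫ _, Real.exp (a / γ) ∂μ) = -a := by
  simp [mul_div_cancel₀ a hγ]

lemma ContinuousOn.integrable_of_measure_compl_eq_zero {E : Type*} [TopologicalSpace E]
    [T2Space E] [MeasurableSpace E] [OpensMeasurableSpace E] {μ : Measure E} [IsFiniteMeasure μ]
    {X : Set E} {h : E → ℝ} (hh : ContinuousOn h X) (hX : IsCompact X) (hμ : μ Xᶜ = 0) :
    Integrable h μ := by
  rw [← Measure.restrict_eq_self_of_ae_mem (mem_ae_iff.2 hμ)]
  exact hh.integrableOn_compact hX

/-- **Boundedness of the Sinkhorn potentials.** If `(f, g)` satisfy the Sinkhorn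
fixed point equations `g = A(f, α)`, `f = A(g, β)` on the compact set `X`, with
`0 ≤ c ≤ M_c` on `X × X` and the normalization `f(x₀) = 0` for some `x₀ ∈ X`,
then `‖f‖∞ ≤ 2 M_c` and `‖g‖∞ ≤ 2 M_c`. -/
theorem sinkhorn_potentials_bounded
    {q : ℕ} (X : Set (EuclideanSpace ℝ (Fin q))) (hX : IsCompact X)
    (γ : ℝ) (hγ : 0 < γ) (Mc : ℝ)
    (c : EuclideanSpace ℝ (Fin q) → EuclideanSpace ℝ (Fin q) → ℝ)
    (hc_cont : ContinuousOn (fun p : EuclideanSpace ℝ (Fin q) × EuclideanSpace ℝ (Fin q) =>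
      c p.1 p.2) (X ×ˢ X))
    (hc_bd : ∀ x ∈ X, ∀ y ∈ X, 0 ≤ c x y ∧ c x y ≤ Mc)
    (α β : Measure (EuclideanSpace ℝ (Fin q)))
    [IsProbabilityMeasure α] [IsProbabilityMeasure β]
    (hα : α Xᶜ = 0) (hβ : β Xᶜ = 0)
    (f g : EuclideanSpace ℝ (Fin q) → ℝ)
    (hf_cont : ContinuousOn f X) (hg_cont : ContinuousOn g X)
    (hg_eq : ∀ y ∈ X, g y = sinkhornMap γ c f α y)
    (hf_eq : ∀ x ∈ X, f x = sinkhornMap γ c g β x)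
    (x₀ : EuclideanSpace ℝ (Fin q)) (hx₀ : x₀ ∈ X) (hf₀ : f x₀ = 0) :
    (∀ x ∈ X, |f x| ≤ 2 * Mc) ∧ (∀ x ∈ X, |g x| ≤ 2 * Mc) := by
  have hint : ∀ (μ : Measure (EuclideanSpace ℝ (Fin q))) [IsProbabilityMeasure μ], μ Xᶜ = 0 →
      ∀ h : EuclideanSpace ℝ (Fin q) → ℝ, ContinuousOn h X → ∀ y ∈ X,
      Integrable (fun x => Real.exp ((h x - c x y) / γ)) μ := by
    intro μ _ hμ h hh y hy
    refine ContinuousOn.integrable_of_measure_compl_eq_zero ?_ hX hμ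
    have hcy : ContinuousOn (fun x => c x y) X :=
      hc_cont.comp (f := fun x => (x, y)) (by fun_prop) fun x hx => ⟨hx, hy⟩
    exact ((hh.sub hcy).div_const γ).rexp
  have hconst : ∀ a : ℝ, Integrable (fun _ => Real.exp (a / γ)) α := fun _ => integrable_const _
  have hαX : ∀ᵐ x ∂α, x ∈ X := mem_ae_iff.2 hα
  have hβX : ∀ᵐ x ∂β, x ∈ X := mem_ae_iff.2 hβ
  have hosc : ∀ x ∈ X, ∀ y ∈ X, f x ≤ f y + Mc := by
    intro x hx y hy
    rw [hf_eq x hx, hf_eq y hy]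
    refine neg_mul_log_integral_exp_div_le hγ (hint β hβ g hg_cont y hy)
      (hint β hβ g hg_cont x hx) ?_
    filter_upwards [hβX] with z hz
    linarith [hc_bd z hz x hx, hc_bd z hz y hy]
  have hf_bd : ∀ x ∈ X, -Mc ≤ f x ∧ f x ≤ Mc := fun x hx =>
    ⟨by linarith [hosc x₀ hx₀ x hx], by linarith [hosc x hx x₀ hx₀]⟩
  have hMc : 0 ≤ Mc := (hc_bd x₀ hx₀ x₀ hx₀).1.trans (hc_bd x₀ hx₀ x₀ hx₀).2
  refine ⟨fun x hx => abs_le.2 ?_, fun y hy => abs_le.2 ?_⟩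
  · constructor <;> linarith [hf_bd x hx]
  · rw [hg_eq y hy]
    have hupper := neg_mul_log_integral_exp_div_le (K := 2 * Mc) hγ (hconst 0)
      (hint α hα f hf_cont y hy) (by
        filter_upwards [hαX] with z hz
        linarith [hf_bd z hz, hc_bd z hz y hy])
    have hlower := neg_mul_log_integral_exp_div_le (K := Mc) hγ (hint α hα f hf_cont y hy)
      (hconst 0) (by
        filter_upwards [hαX] with z hz
        linarith [hf_bd z hz, hc_bd z hz y hy])
    rw [neg_mul_log_integral_exp_const_div α hγ.ne'] at hupper hlower
    unfold sinkhornMap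
    constructor <;> linarith
end

section
/- Let X ⊆ ℝ^q be compact, γ > 0, c : X × X → ℝ continuous, and α a probability measure on X. Then the Sinkhorn mapping f ↦ A(f, α) is nonexpansive in the sup norm: for all continuous f, f' : X → ℝ, ‖A(f, α) − A(f', α)‖∞ ≤ ‖f − f'‖∞. -/
open MeasureTheory

/-- The exponential kernel defining the Sinkhorn mapping is integrable. -/
theorem integrable_exp_sub_cost_div {q : ℕ} {X : Set (EuclideanSpace ℝ (Fin q))}
    (hX : IsCompact X) (γ : ℝ)
    {c : EuclideanSpace ℝ (Fin q) → EuclideanSpace ℝ (Fin q) → ℝ}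
    (hc : ContinuousOn (fun p : EuclideanSpace ℝ (Fin q) × EuclideanSpace ℝ (Fin q) =>
      c p.1 p.2) (X ×ˢ X))
    {α : Measure (EuclideanSpace ℝ (Fin q))} [IsFiniteMeasure α] (hα : α Xᶜ = 0)
    {f : EuclideanSpace ℝ (Fin q) → ℝ} (hf : ContinuousOn f X)
    {y : EuclideanSpace ℝ (Fin q)} (hy : y ∈ X) :
    Integrable (fun x => Real.exp ((f x - c x y) / γ)) α := by
  have hcy : ContinuousOn (fun x => c x y) X :=
    hc.comp (f := fun x => (x, y)) (by fun_prop) fun x hx => ⟨hx, hy⟩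
  have hint : IntegrableOn (fun x => Real.exp ((f x - c x y) / γ)) X α :=
    ((hf.sub hcy).div_const γ).rexp.integrableOn_compact hX
  rwa [IntegrableOn, Measure.restrict_eq_self_of_ae_mem (mem_ae_iff.mpr hα)] at hint

/-- If `f ≤ g + M` almost everywhere, then `A(g, α) y ≤ A(f, α) y + M`. -/
theorem sinkhornMap_sub_le {q : ℕ} {γ : ℝ} (hγ : 0 < γ)
    {c : EuclideanSpace ℝ (Fin q) → EuclideanSpace ℝ (Fin q) → ℝ}
    {α : Measure (EuclideanSpace ℝ (Fin q))} [NeZero α]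
    {f g : EuclideanSpace ℝ (Fin q) → ℝ} {y : EuclideanSpace ℝ (Fin q)}
    (hf : Integrable (fun x => Real.exp ((f x - c x y) / γ)) α)
    (hg : Integrable (fun x => Real.exp ((g x - c x y) / γ)) α)
    {M : ℝ} (h : ∀ᵐ x ∂α, f x - g x ≤ M) :
    sinkhornMap γ c g α y - sinkhornMap γ c f α y ≤ M := by
  have hle : ∫ x, Real.exp ((f x - c x y) / γ) ∂α ≤
      Real.exp (M / γ) * ∫ x, Real.exp ((g x - c x y) / γ) ∂α := by
    rw [← integral_const_mul]
    refine integral_mono_ae hf (hg.const_mul _) ?_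
    filter_upwards [h] with x hx
    rw [← Real.exp_add, ← add_div]
    gcongr
    linarith
  have hlog := Real.log_le_log (integral_exp_pos hf) hle
  rw [Real.log_mul (Real.exp_ne_zero _) (integral_exp_pos hg).ne', Real.log_exp] at hlog
  have hmul := mul_le_mul_of_nonneg_left hlog hγ.le
  rw [mul_add, mul_div_cancel₀ M hγ.ne'] at hmul
  simp only [sinkhornMap]
  linarith

/-- **Nonexpansiveness of the Sinkhorn mapping in the sup norm:**
`‖A(f, α) - A(f', α)‖∞ ≤ ‖f - f'‖∞` on the compact set `X`. -/
theorem sinkhornMap_nonexpansive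
    {q : ℕ} (X : Set (EuclideanSpace ℝ (Fin q))) (hX : IsCompact X)
    (γ : ℝ) (hγ : 0 < γ)
    (c : EuclideanSpace ℝ (Fin q) → EuclideanSpace ℝ (Fin q) → ℝ)
    (hc_cont : ContinuousOn (fun p : EuclideanSpace ℝ (Fin q) × EuclideanSpace ℝ (Fin q) =>
      c p.1 p.2) (X ×ˢ X))
    (α : Measure (EuclideanSpace ℝ (Fin q))) [IsProbabilityMeasure α]
    (hα : α Xᶜ = 0)
    (f f' : EuclideanSpace ℝ (Fin q) → ℝ)
    (hf_cont : ContinuousOn f X) (hf'_cont : ContinuousOn f' X) :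
    ∀ y ∈ X, |sinkhornMap γ c f α y - sinkhornMap γ c f' α y| ≤
      sSup ((fun x => |f x - f' x|) '' X) := by
  intro y hy
  have hbound : ∀ᵐ x ∂α, |f x - f' x| ≤ sSup ((fun x => |f x - f' x|) '' X) := by
    filter_upwards [mem_ae_iff.mpr hα] with x hx
    exact le_csSup (hX.bddAbove_image (hf_cont.sub hf'_cont).abs) (Set.mem_image_of_mem _ hx)
  have hf := integrable_exp_sub_cost_div hX γ hc_cont hα hf_cont hy
  have hf' := integrable_exp_sub_cost_div hX γ hc_cont hα hf'_cont hy
  refine abs_sub_le_iff.mpr ⟨sinkhornMap_sub_le hγ hf' hf ?_, sinkhornMap_sub_le hγ hf hf' ?_⟩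
  · filter_upwards [hbound] with x hx using (abs_sub_le_iff.mp hx).2
  · filter_upwards [hbound] with x hx using (abs_sub_le_iff.mp hx).1
end

section
/- Let X ⊆ ℝ^q be compact, γ > 0, c : X × X → ℝ continuous with 0 ≤ c(x,y) ≤ M_c, and set λ := (exp(M_c/γ) − 1)/(exp(M_c/γ) + 1) < 1. Then for every probability measure α on X and all continuous f, f' : X → ℝ, osc(A(f, α) − A(f', α)) ≤ λ · osc(f − f'), where osc(h) := sup_{x∈X} h(x) − inf_{x∈X} h(x). -/
open MeasureTheory

/-- The oscillation seminorm `osc(h) = sup_X h - inf_X h` on the set `X`. -/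
noncomputable def oscOn {q : ℕ} (X : Set (EuclideanSpace ℝ (Fin q)))
    (h : EuclideanSpace ℝ (Fin q) → ℝ) : ℝ :=
  sSup (h '' X) - sInf (h '' X)

open Real in
/-- The extremal cross-ratio bound behind the Birkhoff–Hopf theorem, for two points. -/
lemma birkhoff_cross_ratio_le {ρ τ S T S' T' : ℝ} (hρ : 1 ≤ ρ) (hτ : 1 ≤ τ)
    (hS : 0 ≤ S) (hT : 0 ≤ T) (hS' : 0 ≤ S') (hT' : 0 ≤ T')
    (hSS : S' ≤ τ * S) (hTT : T ≤ τ * T') :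
    (ρ + τ) ^ 2 * ((T' + ρ ^ 2 * S') * (T + S)) ≤
      (1 + ρ * τ) ^ 2 * ((T + ρ ^ 2 * S) * (T' + S')) := by
  have h_cross : S' * T ≤ τ ^ 2 * (S * T') := by
    calc S' * T ≤ (τ * S) * (τ * T') := by gcongr
      _ = τ ^ 2 * (S * T') := by ring
  set m := √(S' * T) with hm
  set n := √(S * T') with hn
  have hm2 : m ^ 2 = S' * T := sq_sqrt (by positivity)
  have hn2 : n ^ 2 = S * T' := sq_sqrt (by positivity)
  have hm0 : 0 ≤ m := sqrt_nonneg _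
  have hn0 : 0 ≤ n := sqrt_nonneg _
  have hmn : m ≤ τ * n := by
    apply abs_le_of_sq_le_sq' _ (by positivity) |>.2
    rw [mul_pow, hm2, hn2]
    exact h_cross
  have amgm : 2 * ρ * (m * n) ≤ T * T' + ρ ^ 2 * (S * S') := by
    apply abs_le_of_sq_le_sq' _ (by positivity) |>.2
    have : (2 * ρ * (m * n)) ^ 2 = 4 * (T * T') * (ρ ^ 2 * (S * S')) := by
      calc (2 * ρ * (m * n)) ^ 2 = 4 * ρ ^ 2 * (m ^ 2 * n ^ 2) := by ring
        _ = _ := by rw [hm2, hn2]; ring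
    nlinarith [sq_nonneg (T * T' - ρ ^ 2 * (S * S'))]
  have hρ2 : 0 ≤ ρ ^ 2 - 1 := by nlinarith
  have hτ2 : 0 ≤ τ ^ 2 - 1 := by nlinarith
  have h_sq : 0 ≤ (1 + ρ ^ 2) * (τ ^ 2 * n ^ 2 - m ^ 2) := by
    rw [hm2, hn2]
    exact mul_nonneg (by positivity) (by linarith)
  have h_prod : 0 ≤ 2 * ρ * ((τ * n - m) * (n + τ * m)) :=
    mul_nonneg (by positivity) (mul_nonneg (by linarith) (by positivity))
  have key : 0 ≤ (ρ ^ 2 - 1) * ((τ ^ 2 - 1) * (T * T' + ρ ^ 2 * (S * S'))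
      + τ * (τ + 2 * ρ + ρ ^ 2 * τ) * n ^ 2 - (1 + 2 * ρ * τ + ρ ^ 2) * m ^ 2) := by
    apply mul_nonneg hρ2
    linarith [mul_le_mul_of_nonneg_left amgm hτ2]
  rw [hm2, hn2] at key
  linarith

/-- The cross-ratio of integrals against two comparable densities `p`, `p'`, for a weight `w`
with values in `[a, ρ² a]`. -/
lemma integral_cross_ratio_le {Ω : Type*} [MeasurableSpace Ω] {μ : Measure Ω}
    {p p' w : Ω → ℝ} {a ρ τ : ℝ} (hρ : 1 ≤ ρ) (hτ : 1 ≤ τ) (ha : 0 < a)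
    (hp : Integrable p μ) (hp' : Integrable p' μ)
    (hwp : Integrable (fun x => w x * p x) μ) (hwp' : Integrable (fun x => w x * p' x) μ)
    (hp0 : ∀ᵐ x ∂μ, 0 ≤ p x) (hp0' : ∀ᵐ x ∂μ, 0 ≤ p' x)
    (hle : ∀ᵐ x ∂μ, p x ≤ τ * p' x) (hle' : ∀ᵐ x ∂μ, p' x ≤ τ * p x)
    (haw : ∀ᵐ x ∂μ, a ≤ w x) (hwb : ∀ᵐ x ∂μ, w x ≤ ρ ^ 2 * a) :
    (ρ + τ) ^ 2 * ((∫ x, w x * p' x ∂μ) * ∫ x, p x ∂μ) ≤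
      (1 + ρ * τ) ^ 2 * ((∫ x, w x * p x ∂μ) * ∫ x, p' x ∂μ) := by
  have lower {r : Ω → ℝ} (hr : Integrable r μ) (hwr : Integrable (fun x => w x * r x) μ) :
      ∫ x, (w x - a) * r x ∂μ = (∫ x, w x * r x ∂μ) - a * ∫ x, r x ∂μ := by
    simp_rw [sub_mul]
    rw [integral_sub hwr (hr.const_mul a), integral_const_mul]
  have upper {r : Ω → ℝ} (hr : Integrable r μ) (hwr : Integrable (fun x => w x * r x) μ) :
      ∫ x, (ρ ^ 2 * a - w x) * r x ∂μ = ρ ^ 2 * a * (∫ x, r x ∂μ) - ∫ x, w x * r x ∂μ := by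
    simp_rw [sub_mul]
    rw [integral_sub (hr.const_mul _) hwr, integral_const_mul]
  have lower_int {r : Ω → ℝ} (hr : Integrable r μ) (hwr : Integrable (fun x => w x * r x) μ) :
      Integrable (fun x => (w x - a) * r x) μ := by
    simp_rw [sub_mul]
    exact hwr.sub (hr.const_mul a)
  have upper_int {r : Ω → ℝ} (hr : Integrable r μ) (hwr : Integrable (fun x => w x * r x) μ) :
      Integrable (fun x => (ρ ^ 2 * a - w x) * r x) μ := by
    simp_rw [sub_mul]
    exact (hr.const_mul _).sub hwr
  have lower_nonneg {r : Ω → ℝ} (hr : ∀ᵐ x ∂μ, 0 ≤ r x) : 0 ≤ ∫ x, (w x - a) * r x ∂μ := by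
    apply integral_nonneg_of_ae
    filter_upwards [hr, haw] with x h1 h2 using mul_nonneg (by linarith) h1
  have upper_nonneg {r : Ω → ℝ} (hr : ∀ᵐ x ∂μ, 0 ≤ r x) :
      0 ≤ ∫ x, (ρ ^ 2 * a - w x) * r x ∂μ := by
    apply integral_nonneg_of_ae
    filter_upwards [hr, hwb] with x h1 h2 using mul_nonneg (by linarith) h1
  have hSS : ∫ x, (w x - a) * p' x ∂μ ≤ τ * ∫ x, (w x - a) * p x ∂μ := by
    rw [← integral_const_mul]
    apply integral_mono_ae (lower_int hp' hwp') ((lower_int hp hwp).const_mul τ)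
    filter_upwards [hle', haw] with x h1 h2
    linarith [mul_le_mul_of_nonneg_left h1 (sub_nonneg.2 h2)]
  have hTT : ∫ x, (ρ ^ 2 * a - w x) * p x ∂μ ≤ τ * ∫ x, (ρ ^ 2 * a - w x) * p' x ∂μ := by
    rw [← integral_const_mul]
    apply integral_mono_ae (upper_int hp hwp) ((upper_int hp' hwp').const_mul τ)
    filter_upwards [hle, hwb] with x h1 h2
    linarith [mul_le_mul_of_nonneg_left h1 (sub_nonneg.2 h2)]
  have key := birkhoff_cross_ratio_le hρ hτ (lower_nonneg hp0) (upper_nonneg hp0)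
    (lower_nonneg hp0') (upper_nonneg hp0') hSS hTT
  have hS := lower_nonneg hp0
  have hT := upper_nonneg hp0
  have hS' := lower_nonneg hp0'
  have hT' := upper_nonneg hp0'
  rw [lower hp hwp, lower hp' hwp', upper hp hwp, upper hp' hwp'] at key
  rw [lower hp hwp] at hS
  rw [upper hp hwp] at hT
  rw [lower hp' hwp'] at hS'
  rw [upper hp' hwp'] at hT'
  rcases hρ.eq_or_lt with rfl | hρ1
  · rw [show ∫ x, w x * p x ∂μ = a * ∫ x, p x ∂μ by linarith,
      show ∫ x, w x * p' x ∂μ = a * ∫ x, p' x ∂μ by linarith]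
    exact le_of_eq (by ring)
  · have hpos : 0 < (ρ ^ 2 - 1) ^ 2 * a := by
      have : 0 < ρ ^ 2 - 1 := by nlinarith
      positivity
    refine le_of_mul_le_mul_left ?_ hpos
    linarith

open Real in
lemma log_one_add_mul_exp_sub_le {τ t : ℝ} (hτ : 1 ≤ τ) (ht : 0 ≤ t) :
    log (1 + τ * exp t) - log (exp t + τ) ≤ (τ - 1) / (τ + 1) * t := by
  let F : ℝ → ℝ := fun t => (τ - 1) / (τ + 1) * t - (log (1 + τ * exp t) - log (exp t + τ))
  have hd (t : ℝ) : HasDerivAt F ((τ - 1) / (τ + 1) * 1 -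
      (τ * exp t / (1 + τ * exp t) - exp t / (exp t + τ))) t :=
    ((hasDerivAt_id t).const_mul _).sub
      (((((hasDerivAt_exp t).const_mul τ).const_add 1).log (by positivity)).sub
        (((hasDerivAt_exp t).add_const τ).log (by positivity)))
  have hmono : Monotone F := by
    apply monotone_of_hasDerivAt_nonneg hd
    intro t
    have : (τ - 1) / (τ + 1) * 1 - (τ * exp t / (1 + τ * exp t) - exp t / (exp t + τ)) =
        (τ - 1) * τ * (exp t - 1) ^ 2 / ((τ + 1) * (1 + τ * exp t) * (exp t + τ)) := by
      field_simp
      ring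
    dsimp only
    rw [this]
    have : 0 ≤ τ - 1 := by linarith
    positivity
  have h0 : F 0 = 0 := by simp [F, add_comm]
  have := hmono ht
  rw [h0] at this
  simp only [F] at this
  linarith

/-- **Birkhoff–Hopf contraction of the Sinkhorn mapping.** With
`λ = (exp(M_c/γ) - 1)/(exp(M_c/γ) + 1) < 1`, one has
`osc(A(f, α) - A(f', α)) ≤ λ · osc(f - f')`. -/
theorem sinkhornMap_osc_contraction
    {q : ℕ} (X : Set (EuclideanSpace ℝ (Fin q))) (hX : IsCompact X)
    (γ : ℝ) (hγ : 0 < γ) (Mc : ℝ)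
    (c : EuclideanSpace ℝ (Fin q) → EuclideanSpace ℝ (Fin q) → ℝ)
    (hc_cont : ContinuousOn (fun p : EuclideanSpace ℝ (Fin q) × EuclideanSpace ℝ (Fin q) =>
      c p.1 p.2) (X ×ˢ X))
    (hc_bd : ∀ x ∈ X, ∀ y ∈ X, 0 ≤ c x y ∧ c x y ≤ Mc)
    (lam : ℝ) (hlam : lam = (Real.exp (Mc / γ) - 1) / (Real.exp (Mc / γ) + 1))
    (α : Measure (EuclideanSpace ℝ (Fin q))) [IsProbabilityMeasure α]
    (hα : α Xᶜ = 0)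
    (f f' : EuclideanSpace ℝ (Fin q) → ℝ)
    (hf_cont : ContinuousOn f X) (hf'_cont : ContinuousOn f' X) :
    lam < 1 ∧
    oscOn X (fun y => sinkhornMap γ c f α y - sinkhornMap γ c f' α y) ≤
      lam * oscOn X (fun x => f x - f' x) := by
  have hlt : lam < 1 := by
    rw [hlam, div_lt_one (by positivity)]
    linarith
  refine ⟨hlt, ?_⟩
  have hX_ae : ∀ᵐ x ∂α, x ∈ X := hα
  obtain ⟨x₀, hx₀⟩ : X.Nonempty := hX_ae.exists
  have hrestrict : α.restrict X = α := Measure.restrict_eq_self_of_ae_mem hX_ae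
  have hMc : 0 ≤ Mc := (hc_bd x₀ hx₀ x₀ hx₀).1.trans (hc_bd x₀ hx₀ x₀ hx₀).2
  have h_int {g : EuclideanSpace ℝ (Fin q) → ℝ} (hg : ContinuousOn g X) {y}
      (hy : y ∈ X) : Integrable (fun x => Real.exp ((g x - c x y) / γ)) α := by
    have hc : ContinuousOn (fun x => c x y) X :=
      hc_cont.comp (f := fun x => (x, y)) (by fun_prop) fun x hx => ⟨hx, hy⟩
    have h : IntegrableOn (fun x => Real.exp ((g x - c x y) / γ)) X α :=
      ((hg.sub hc).div_const γ).rexp.integrableOn_compact hX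
    rwa [IntegrableOn, hrestrict] at h
  have hcomp := hX.image_of_continuousOn (hf_cont.sub hf'_cont)
  set L := oscOn X (fun x => f x - f' x) with hL
  set m := sInf ((fun x => f x - f' x) '' X) with hm
  have hlow {x} (hx : x ∈ X) : m ≤ f x - f' x :=
    csInf_le hcomp.bddBelow (Set.mem_image_of_mem _ hx)
  have hupp {x} (hx : x ∈ X) : f x - f' x ≤ m + L := by
    have : f x - f' x ≤ sSup ((fun x => f x - f' x) '' X) :=
      le_csSup hcomp.bddAbove (Set.mem_image_of_mem _ hx)
    simp only [hL, oscOn, ← hm]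
    linarith
  have hL0 : 0 ≤ L := by linarith [hlow hx₀, hupp hx₀]
  have key {y} (hy : y ∈ X) {y'} (hy' : y' ∈ X) :
      sinkhornMap γ c f α y - sinkhornMap γ c f' α y ≤
        sinkhornMap γ c f α y' - sinkhornMap γ c f' α y' + lam * L := by
    have hw (x y) : Real.exp ((f x - f' x) / γ) * Real.exp ((f' x - c x y) / γ) =
        Real.exp ((f x - c x y) / γ) := by
      rw [← Real.exp_add]
      ring_nf
    have hcmp {y} (hy : y ∈ X) {y'} (hy' : y' ∈ X) : ∀ᵐ x ∂α, Real.exp ((f' x - c x y) / γ) ≤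
        Real.exp (Mc / γ) * Real.exp ((f' x - c x y') / γ) := by
      filter_upwards [hX_ae] with x hx
      rw [← Real.exp_add, ← add_div]
      gcongr
      linarith [(hc_bd x hx y hy).1, (hc_bd x hx y' hy').2]
    have hρ : 1 ≤ Real.exp (L / (2 * γ)) := Real.one_le_exp (by positivity)
    have hτ : 1 ≤ Real.exp (Mc / γ) := Real.one_le_exp (by positivity)
    have hcross := integral_cross_ratio_le (μ := α) (w := fun x => Real.exp ((f x - f' x) / γ))
      (a := Real.exp (m / γ)) hρ hτ (Real.exp_pos _)
      (h_int hf'_cont hy) (h_int hf'_cont hy')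
      (by simpa only [hw] using h_int hf_cont hy) (by simpa only [hw] using h_int hf_cont hy')
      (.of_forall fun _ => (Real.exp_pos _).le) (.of_forall fun _ => (Real.exp_pos _).le)
      (hcmp hy hy') (hcmp hy' hy)
      (by
        filter_upwards [hX_ae] with x hx
        have := hlow hx
        gcongr)
      (by
        filter_upwards [hX_ae] with x hx
        have h2 : Real.exp (L / (2 * γ)) ^ 2 * Real.exp (m / γ) = Real.exp ((m + L) / γ) := by
          rw [← Real.exp_nat_mul, ← Real.exp_add]
          congr 1
          push_cast
          field_simp
          ring
        rw [h2]
        have := hupp hx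
        gcongr)
    simp only [hw] at hcross
    have hlog := log_one_add_mul_exp_sub_le hτ (show 0 ≤ L / (2 * γ) by positivity)
    rw [← hlam] at hlog
    have hI := integral_exp_pos (h_int hf_cont hy)
    have hI' := integral_exp_pos (h_int hf_cont hy')
    have hJ := integral_exp_pos (h_int hf'_cont hy)
    have hJ' := integral_exp_pos (h_int hf'_cont hy')
    have hcross_log := Real.log_le_log (by positivity) hcross
    rw [Real.log_mul (by positivity) (by positivity), Real.log_mul hI'.ne' hJ.ne',
      Real.log_mul (by positivity) (by positivity), Real.log_mul hI.ne' hJ'.ne',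
      Real.log_pow, Real.log_pow, mul_comm (Real.exp (L / (2 * γ)))] at hcross_log
    push_cast at hcross_log
    have hbound : Real.log (∫ x, Real.exp ((f x - c x y') / γ) ∂α) +
        Real.log (∫ x, Real.exp ((f' x - c x y) / γ) ∂α) -
        Real.log (∫ x, Real.exp ((f x - c x y) / γ) ∂α) -
        Real.log (∫ x, Real.exp ((f' x - c x y') / γ) ∂α) ≤ lam * L / γ := by
      have : lam * L / γ = 2 * (lam * (L / (2 * γ))) := by field_simp
      linarith
    rw [le_div_iff₀ hγ] at hbound
    simp only [sinkhornMap]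
    linarith
  have hne : ((fun y => sinkhornMap γ c f α y - sinkhornMap γ c f' α y) '' X).Nonempty :=
    ⟨_, x₀, hx₀, rfl⟩
  rw [oscOn, sub_le_comm]
  apply le_csInf hne
  rintro _ ⟨y', hy', rfl⟩
  rw [sub_le_iff_le_add]
  apply csSup_le hne
  rintro _ ⟨y, hy, rfl⟩
  exact key hy hy'
end

section
/- Let X ⊆ ℝ^q be compact, γ > 0, c : X × X → ℝ continuous with 0 ≤ c(x,y) ≤ M_c, λ := (exp(M_c/γ) − 1)/(exp(M_c/γ) + 1), and let α, β be probability measures on X. Define B(f) := A(A(f, α), β). Suppose f* is a continuous fixed point of B, i.e. B(f*) = f*, and define the Sinkhorn–Knopp iterates f^{t+1} := B(f^t) from any continuous initialization f⁰. Then for all t ≥ 0, osc(f^t − f*) ≤ λ^{2t} · osc(f⁰ − f*), where osc(h) := sup_X h − inf_X h. -/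
open MeasureTheory

/-- The Sinkhorn–Knopp operator `B(f) := A(A(f, α), β)`. -/
noncomputable def sinkhornKnopp {q : ℕ} (γ : ℝ)
    (c : EuclideanSpace ℝ (Fin q) → EuclideanSpace ℝ (Fin q) → ℝ)
    (α β : Measure (EuclideanSpace ℝ (Fin q)))
    (f : EuclideanSpace ℝ (Fin q) → ℝ) :
    EuclideanSpace ℝ (Fin q) → ℝ :=
  sinkhornMap γ c (sinkhornMap γ c f α) β

/-- The scalar inequality behind Birkhoff's contraction theorem. -/
theorem exp_mul_add_one_div_le {L : ℝ} (hL : 1 ≤ L) {r : ℝ} (hr : 0 ≤ r) :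
    (Real.exp r * L + 1) / (Real.exp r + L) ≤ Real.exp ((L - 1) / (L + 1) * r) := by
  have hL0 : 0 < L := by linarith
  have hpos1 : ∀ x, 0 < Real.exp x * L + 1 := fun x => by positivity
  have hpos2 : ∀ x, 0 < Real.exp x + L := fun x => by positivity
  let φ : ℝ → ℝ := fun x =>
    (L - 1) / (L + 1) * x - Real.log (Real.exp x * L + 1) + Real.log (Real.exp x + L)
  have hderiv : ∀ x, HasDerivAt φ ((L - 1) / (L + 1) - Real.exp x * L / (Real.exp x * L + 1)
      + Real.exp x / (Real.exp x + L)) x := by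
    intro x
    have h1 := (((Real.hasDerivAt_exp x).mul_const L).add_const 1).log (hpos1 x).ne'
    have h2 := ((Real.hasDerivAt_exp x).add_const L).log (hpos2 x).ne'
    have h3 := (hasDerivAt_id x).const_mul ((L - 1) / (L + 1))
    rw [mul_one] at h3
    exact (h3.sub h1).add h2
  have hmono : Monotone φ := by
    refine monotone_of_deriv_nonneg (fun x => (hderiv x).differentiableAt) fun x => ?_
    rw [(hderiv x).deriv]
    have h1 := hpos1 x
    have h2 := hpos2 x
    have key : (L - 1) / (L + 1) - Real.exp x * L / (Real.exp x * L + 1)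
        + Real.exp x / (Real.exp x + L) =
        (L - 1) * L * (Real.exp x - 1) ^ 2 /
          ((L + 1) * (Real.exp x * L + 1) * (Real.exp x + L)) := by
      field_simp
      ring
    rw [key]
    have : 0 ≤ L - 1 := by linarith
    positivity
  have h := hmono hr
  simp only [φ, Real.exp_zero, mul_zero, one_mul, add_comm L 1] at h
  rw [← Real.log_le_iff_le_exp (div_pos (hpos1 r) (hpos2 r)),
    Real.log_div (hpos1 r).ne' (hpos2 r).ne', add_comm L 1]
  linarith

/-- If `P, P'` are the integrals of a function with values in `[m, s ^ 2 * m]` against two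
weights of masses `W, W'`, each at most `L` times the other, then the averages `P / W` and
`P' / W'` differ by a factor of at most `((s * L + 1) / (s + L)) ^ 2`. -/
theorem mul_mul_sq_le_of_comparable {m s L P P' W W' : ℝ} (hm : 0 < m) (hs : 1 ≤ s)
    (hL : 1 ≤ L) (hW : 0 < W) (hW' : 0 < W')
    (hA : 0 ≤ P - m * W) (hA' : 0 ≤ P' - m * W')
    (hC : 0 ≤ s ^ 2 * m * W - P) (hC' : 0 ≤ s ^ 2 * m * W' - P')
    (hAA' : P - m * W ≤ L * (P' - m * W'))
    (hCC' : s ^ 2 * m * W' - P' ≤ L * (s ^ 2 * m * W - P)) :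
    P * W' * (s + L) ^ 2 ≤ (s * L + 1) ^ 2 * (P' * W) := by
  set a := P' - m * W' with ha
  set b := s ^ 2 * m * W' - P' with hb
  have hcross : (P - m * W) * b ≤ L * a * (L * (s ^ 2 * m * W - P)) :=
    mul_le_mul hAA' hCC' hC' (hA.trans hAA')
  have hP : P * (b + L ^ 2 * a) ≤ W * (m * b + L ^ 2 * (s ^ 2 * m) * a) := by
    linarith
  have hid : (s * L + 1) ^ 2 * P' * (b + L ^ 2 * a)
      - (m * b + L ^ 2 * (s ^ 2 * m) * a) * W' * (s + L) ^ 2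
      = (L ^ 2 - 1) * ((s * L + 1) * P' - s * (s + L) * (m * W')) ^ 2 := by
    rw [ha, hb]
    ring
  have hL2 : 0 ≤ L ^ 2 - 1 := by nlinarith
  have hquad : (m * b + L ^ 2 * (s ^ 2 * m) * a) * W' * (s + L) ^ 2
      ≤ (s * L + 1) ^ 2 * P' * (b + L ^ 2 * a) := by
    have := mul_nonneg hL2 (sq_nonneg ((s * L + 1) * P' - s * (s + L) * (m * W')))
    linarith
  have hL0 : 0 < L := by linarith
  rcases (show 0 ≤ b + L ^ 2 * a by positivity).eq_or_lt with hD | hD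
  · have hb0 : b = 0 := le_antisymm (by nlinarith [mul_nonneg (sq_nonneg L) hA']) hC'
    have ha0 : a = 0 := by
      rw [hb0, zero_add] at hD
      exact (mul_eq_zero.mp hD.symm).resolve_left (by positivity)
    have hs1 : s = 1 := by
      have h0 : (s ^ 2 - 1) * (m * W') = 0 := by linarith
      have h1 : s ^ 2 - 1 = 0 := (mul_eq_zero.mp h0).resolve_right (by positivity)
      nlinarith
    subst hs1
    have hP1 : P = m * W := by linarith
    have hP2 : P' = m * W' := by linarith
    rw [hP1, hP2]
    exact le_of_eq (by ring)
  · refine le_of_mul_le_mul_right ?_ hD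
    have h1 := mul_le_mul_of_nonneg_right hP (show 0 ≤ W' * (s + L) ^ 2 by positivity)
    have h2 := mul_le_mul_of_nonneg_left hquad hW.le
    linarith

section Sinkhorn

variable {q : ℕ} {X : Set (EuclideanSpace ℝ (Fin q))} {γ Mc : ℝ}
  {c : EuclideanSpace ℝ (Fin q) → EuclideanSpace ℝ (Fin q) → ℝ}
  {f g : EuclideanSpace ℝ (Fin q) → ℝ}
  {μ : Measure (EuclideanSpace ℝ (Fin q))}

theorem integrable_of_continuousOn_of_compl_null [IsFiniteMeasure μ] (hX : IsCompact X)
    (hμ : μ Xᶜ = 0) (hf : ContinuousOn f X) : Integrable f μ := by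
  have h := hf.integrableOn_compact (μ := μ) hX
  rwa [IntegrableOn, Measure.restrict_eq_self_of_ae_mem (mem_ae_iff.mpr hμ)] at h

theorem nonempty_of_compl_null [IsProbabilityMeasure μ] (hμ : μ Xᶜ = 0) : X.Nonempty :=
  Filter.nonempty_of_mem (mem_ae_iff.mpr hμ)

theorem continuousOn_sinkhornKernel
    (hc : ContinuousOn (fun p : EuclideanSpace ℝ (Fin q) × EuclideanSpace ℝ (Fin q) =>
      c p.1 p.2) (X ×ˢ X)) (hf : ContinuousOn f X) {y : EuclideanSpace ℝ (Fin q)}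
    (hy : y ∈ X) : ContinuousOn (fun x => Real.exp ((f x - c x y) / γ)) X := by
  have h : ContinuousOn (fun x => c x y) X :=
    hc.comp (f := fun x => (x, y)) (by fun_prop) fun x hx => ⟨hx, hy⟩
  fun_prop

theorem integral_sinkhornKernel_pos [IsProbabilityMeasure μ] (hX : IsCompact X)
    (hc : ContinuousOn (fun p : EuclideanSpace ℝ (Fin q) × EuclideanSpace ℝ (Fin q) =>
      c p.1 p.2) (X ×ˢ X)) (hμ : μ Xᶜ = 0) (hf : ContinuousOn f X)
    {y : EuclideanSpace ℝ (Fin q)} (hy : y ∈ X) :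
    0 < ∫ x, Real.exp ((f x - c x y) / γ) ∂μ :=
  integral_exp_pos <|
    integrable_of_continuousOn_of_compl_null hX hμ (continuousOn_sinkhornKernel hc hf hy)

theorem continuousOn_sinkhornMap [IsProbabilityMeasure μ] (hX : IsCompact X) (hγ : 0 < γ)
    (hc : ContinuousOn (fun p : EuclideanSpace ℝ (Fin q) × EuclideanSpace ℝ (Fin q) =>
      c p.1 p.2) (X ×ˢ X)) (hc_nonneg : ∀ x ∈ X, ∀ y ∈ X, 0 ≤ c x y)
    (hμ : μ Xᶜ = 0) (hf : ContinuousOn f X) : ContinuousOn (sinkhornMap γ c f μ) X := by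
  have hmem : ∀ᵐ x ∂μ, x ∈ X := mem_ae_iff.mpr hμ
  have hint : ContinuousOn (fun y => ∫ x, Real.exp ((f x - c x y) / γ) ∂μ) X := by
    refine continuousOn_of_dominated (bound := fun x => Real.exp (f x / γ)) ?_ ?_ ?_ ?_
    · exact fun y hy => (integrable_of_continuousOn_of_compl_null hX hμ
        (continuousOn_sinkhornKernel hc hf hy)).aestronglyMeasurable
    · intro y hy
      filter_upwards [hmem] with x hx
      rw [Real.norm_of_nonneg (Real.exp_pos _).le]
      have := hc_nonneg x hx y hy
      gcongr
      linarith
    · exact integrable_of_continuousOn_of_compl_null hX hμ (by fun_prop)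
    · filter_upwards [hmem] with x hx
      have h : ContinuousOn (fun y => c x y) X :=
        hc.comp (f := fun y => (x, y)) (by fun_prop) fun y hy => ⟨hx, hy⟩
      fun_prop
  exact (hint.log fun y hy => (integral_sinkhornKernel_pos hX hc hμ hf hy).ne').const_mul (-γ)

theorem oscOn_nonneg (hX : IsCompact X) (hf : ContinuousOn f X) : 0 ≤ oscOn X f :=
  sub_nonneg.mpr <| Real.sInf_le_sSup _ (hX.image_of_continuousOn hf).bddBelow
    (hX.image_of_continuousOn hf).bddAbove

theorem oscOn_le_of_forall_sub_le (hX : X.Nonempty) {D : ℝ}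
    (h : ∀ x ∈ X, ∀ y ∈ X, f x - f y ≤ D) : oscOn X f ≤ D := by
  have key : sSup (f '' X) ≤ D + sInf (f '' X) := by
    refine csSup_le (hX.image f) ?_
    rintro _ ⟨x, hx, rfl⟩
    rw [← sub_le_iff_le_add']
    refine le_csInf (hX.image f) ?_
    rintro _ ⟨y, hy, rfl⟩
    linarith [h x hx y hy]
  rw [oscOn]
  linarith

theorem oscOn_congr (h : Set.EqOn f g X) : oscOn X f = oscOn X g := by
  rw [oscOn, oscOn, h.image_eq]

/-- Integrals of a nonnegative function against the Sinkhorn kernels at two points are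
comparable. -/
theorem integral_mul_sinkhornKernel_le [IsProbabilityMeasure μ] (hX : IsCompact X)
    (hγ : 0 < γ)
    (hc : ContinuousOn (fun p : EuclideanSpace ℝ (Fin q) × EuclideanSpace ℝ (Fin q) =>
      c p.1 p.2) (X ×ˢ X)) (hc_bd : ∀ x ∈ X, ∀ y ∈ X, 0 ≤ c x y ∧ c x y ≤ Mc)
    (hμ : μ Xᶜ = 0) (hg : ContinuousOn g X) {v : EuclideanSpace ℝ (Fin q) → ℝ}
    (hv : ContinuousOn v X) (hv0 : ∀ x ∈ X, 0 ≤ v x) {y y' : EuclideanSpace ℝ (Fin q)}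
    (hy : y ∈ X) (hy' : y' ∈ X) :
    ∫ x, v x * Real.exp ((g x - c x y) / γ) ∂μ ≤
      Real.exp (Mc / γ) * ∫ x, v x * Real.exp ((g x - c x y') / γ) ∂μ := by
  have hmem : ∀ᵐ x ∂μ, x ∈ X := mem_ae_iff.mpr hμ
  rw [← integral_const_mul]
  refine integral_mono_ae
    (integrable_of_continuousOn_of_compl_null hX hμ
      (hv.mul (continuousOn_sinkhornKernel hc hg hy)))
    ((integrable_of_continuousOn_of_compl_null hX hμ
      (hv.mul (continuousOn_sinkhornKernel hc hg hy'))).const_mul _) ?_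
  filter_upwards [hmem] with x hx
  have h : Real.exp ((g x - c x y) / γ) ≤
      Real.exp (Mc / γ) * Real.exp ((g x - c x y') / γ) := by
    rw [← Real.exp_add, ← add_div]
    gcongr
    linarith [(hc_bd x hx y hy).1, (hc_bd x hx y' hy').2]
  calc v x * Real.exp ((g x - c x y) / γ)
      ≤ v x * (Real.exp (Mc / γ) * Real.exp ((g x - c x y') / γ)) :=
        mul_le_mul_of_nonneg_left h (hv0 x hx)
    _ = Real.exp (Mc / γ) * (v x * Real.exp ((g x - c x y') / γ)) := by ring

/-- The Sinkhorn mapping contracts the oscillation seminorm. -/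
theorem oscOn_sinkhornMap_sub_le [IsProbabilityMeasure μ] (hX : IsCompact X) (hγ : 0 < γ)
    (hc : ContinuousOn (fun p : EuclideanSpace ℝ (Fin q) × EuclideanSpace ℝ (Fin q) =>
      c p.1 p.2) (X ×ˢ X)) (hc_bd : ∀ x ∈ X, ∀ y ∈ X, 0 ≤ c x y ∧ c x y ≤ Mc)
    (hMc : 0 ≤ Mc) (hμ : μ Xᶜ = 0) (hf : ContinuousOn f X) (hg : ContinuousOn g X) :
    oscOn X (fun y => sinkhornMap γ c f μ y - sinkhornMap γ c g μ y) ≤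
      (Real.exp (Mc / γ) - 1) / (Real.exp (Mc / γ) + 1) * oscOn X (fun x => f x - g x) := by
  refine oscOn_le_of_forall_sub_le (nonempty_of_compl_null hμ) fun y' hy' y hy => ?_
  have hmem : ∀ᵐ x ∂μ, x ∈ X := mem_ae_iff.mpr hμ
  have hh : ContinuousOn (fun x => f x - g x) X := hf.sub hg
  have hosc := oscOn_nonneg hX hh
  set D := oscOn X (fun x => f x - g x) with hD
  set L := Real.exp (Mc / γ)
  have hL : 1 ≤ L := Real.one_le_exp (by positivity)
  set lo := sInf ((fun x => f x - g x) '' X)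
  have hlo_le : ∀ x ∈ X, lo ≤ f x - g x := fun x hx =>
    csInf_le (hX.image_of_continuousOn hh).bddBelow ⟨x, hx, rfl⟩
  have hle_hi : ∀ x ∈ X, f x - g x ≤ lo + D := fun x hx => by
    have : f x - g x ≤ sSup ((fun x => f x - g x) '' X) :=
      le_csSup (hX.image_of_continuousOn hh).bddAbove ⟨x, hx, rfl⟩
    rw [hD, oscOn]
    linarith
  set m := Real.exp (lo / γ) with hm
  set s := Real.exp (D / (2 * γ)) with hs
  have hsm : s ^ 2 * m = Real.exp ((lo + D) / γ) := by
    rw [hs, hm, ← Real.exp_nat_mul, ← Real.exp_add]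
    congr 1
    field_simp
    push_cast
    ring
  let u : EuclideanSpace ℝ (Fin q) → ℝ := fun x => Real.exp ((f x - g x) / γ)
  have hu : ContinuousOn u X := by fun_prop
  have hmu : ∀ x ∈ X, 0 ≤ u x - m := fun x hx => by
    have := hlo_le x hx
    simp only [u, hm, sub_nonneg]
    gcongr
  have huM : ∀ x ∈ X, 0 ≤ s ^ 2 * m - u x := fun x hx => by
    have := hle_hi x hx
    simp only [u, hsm, sub_nonneg]
    gcongr
  have hW : ∀ {z}, z ∈ X → Integrable (fun x => Real.exp ((g x - c x z) / γ)) μ := fun hz =>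
    integrable_of_continuousOn_of_compl_null hX hμ (continuousOn_sinkhornKernel hc hg hz)
  have hP : ∀ {z}, z ∈ X → Integrable (fun x => Real.exp ((f x - c x z) / γ)) μ := fun hz =>
    integrable_of_continuousOn_of_compl_null hX hμ (continuousOn_sinkhornKernel hc hf hz)
  have hsplit : ∀ x z, Real.exp ((f x - c x z) / γ) = u x * Real.exp ((g x - c x z) / γ) :=
    fun x z => by
      simp only [u]
      rw [← Real.exp_add]
      congr 1
      ring
  have hlow : ∀ {z}, z ∈ X → ∫ x, (u x - m) * Real.exp ((g x - c x z) / γ) ∂μ =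
      (∫ x, Real.exp ((f x - c x z) / γ) ∂μ)
        - m * ∫ x, Real.exp ((g x - c x z) / γ) ∂μ := fun {z} hz => by
    rw [← integral_const_mul, ← integral_sub (hP hz) ((hW hz).const_mul m)]
    simp only [hsplit, sub_mul]
  have hup : ∀ {z}, z ∈ X → ∫ x, (s ^ 2 * m - u x) * Real.exp ((g x - c x z) / γ) ∂μ =
      s ^ 2 * m * (∫ x, Real.exp ((g x - c x z) / γ) ∂μ)
        - ∫ x, Real.exp ((f x - c x z) / γ) ∂μ := fun {z} hz => by
    rw [← integral_const_mul, ← integral_sub ((hW hz).const_mul _) (hP hz)]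
    simp only [hsplit, sub_mul]
  have hnonneg : ∀ {v : EuclideanSpace ℝ (Fin q) → ℝ}, (∀ x ∈ X, 0 ≤ v x) → ∀ z,
      0 ≤ ∫ x, v x * Real.exp ((g x - c x z) / γ) ∂μ := fun hv z =>
    integral_nonneg_of_ae <| by
      filter_upwards [hmem] with x hx
      exact mul_nonneg (hv x hx) (Real.exp_pos _).le
  have hlow_cont : ContinuousOn (fun x => u x - m) X := by fun_prop
  have hup_cont : ContinuousOn (fun x => s ^ 2 * m - u x) X := by fun_prop
  have hWpos : ∀ {z}, z ∈ X → 0 < ∫ x, Real.exp ((g x - c x z) / γ) ∂μ :=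
    integral_sinkhornKernel_pos hX hc hμ hg
  have hPpos : ∀ {z}, z ∈ X → 0 < ∫ x, Real.exp ((f x - c x z) / γ) ∂μ :=
    integral_sinkhornKernel_pos hX hc hμ hf
  have hD0 : 0 ≤ D / (2 * γ) := by positivity
  have hmain := mul_mul_sq_le_of_comparable (Real.exp_pos (lo / γ)) (Real.one_le_exp hD0) hL
    (hWpos hy) (hWpos hy')
    ((hnonneg hmu y).trans_eq (hlow hy)) ((hnonneg hmu y').trans_eq (hlow hy'))
    ((hnonneg huM y).trans_eq (hup hy)) ((hnonneg huM y').trans_eq (hup hy'))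
    (by
      rw [← hm, ← hlow hy, ← hlow hy']
      exact integral_mul_sinkhornKernel_le hX hγ hc hc_bd hμ hg hlow_cont hmu hy hy')
    (by
      rw [← hm, ← hs, ← hup hy, ← hup hy']
      exact integral_mul_sinkhornKernel_le hX hγ hc hc_bd hμ hg hup_cont huM hy' hy)
  have hscalar := exp_mul_add_one_div_le hL hD0
  simp only [sinkhornMap]
  set P := ∫ x, Real.exp ((f x - c x y) / γ) ∂μ
  set P' := ∫ x, Real.exp ((f x - c x y') / γ) ∂μ
  set W := ∫ x, Real.exp ((g x - c x y) / γ) ∂μ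
  set W' := ∫ x, Real.exp ((g x - c x y') / γ) ∂μ
  have hP0 : 0 < P := hPpos hy
  have hP0' : 0 < P' := hPpos hy'
  have hW0 : 0 < W := hWpos hy
  have hW0' : 0 < W' := hWpos hy'
  have hsL : 0 < s + L := by positivity
  have hbound : P * W' ≤ Real.exp ((L - 1) / (L + 1) * D / γ) * (P' * W) := by
    calc P * W' ≤ ((s * L + 1) / (s + L)) ^ 2 * (P' * W) := by
          rw [div_pow, div_mul_eq_mul_div, le_div_iff₀ (by positivity)]
          exact hmain
      _ ≤ Real.exp ((L - 1) / (L + 1) * (D / (2 * γ))) ^ 2 * (P' * W) := by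
          gcongr
      _ = Real.exp ((L - 1) / (L + 1) * D / γ) * (P' * W) := by
          rw [← Real.exp_nat_mul]
          congr 2
          field_simp
          push_cast
          ring
  have hlog := Real.log_le_log (mul_pos hP0 hW0') hbound
  rw [Real.log_mul hP0.ne' hW0'.ne', Real.log_mul (Real.exp_pos _).ne' (mul_pos hP0' hW0).ne',
    Real.log_mul hP0'.ne' hW0.ne', Real.log_exp] at hlog
  have hγlog := mul_le_mul_of_nonneg_left hlog hγ.le
  rw [mul_add γ (_ / γ), mul_div_cancel₀ _ hγ.ne'] at hγlog
  linarith

end Sinkhorn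

/-- **Linear convergence of the Sinkhorn–Knopp algorithm.** If `f*` is a fixed
point of `B(f) = A(A(f, α), β)` and `f^{t+1} = B(f^t)`, then
`osc(f^t - f*) ≤ λ^{2t} · osc(f⁰ - f*)` with
`λ = (exp(M_c/γ) - 1)/(exp(M_c/γ) + 1)`. -/
theorem sinkhornKnopp_linear_convergence
    {q : ℕ} (X : Set (EuclideanSpace ℝ (Fin q))) (hX : IsCompact X)
    (γ : ℝ) (hγ : 0 < γ) (Mc : ℝ)
    (c : EuclideanSpace ℝ (Fin q) → EuclideanSpace ℝ (Fin q) → ℝ)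
    (hc_cont : ContinuousOn (fun p : EuclideanSpace ℝ (Fin q) × EuclideanSpace ℝ (Fin q) =>
      c p.1 p.2) (X ×ˢ X))
    (hc_bd : ∀ x ∈ X, ∀ y ∈ X, 0 ≤ c x y ∧ c x y ≤ Mc)
    (lam : ℝ) (hlam : lam = (Real.exp (Mc / γ) - 1) / (Real.exp (Mc / γ) + 1))
    (α β : Measure (EuclideanSpace ℝ (Fin q)))
    [IsProbabilityMeasure α] [IsProbabilityMeasure β]
    (hα : α Xᶜ = 0) (hβ : β Xᶜ = 0)
    (fstar : EuclideanSpace ℝ (Fin q) → ℝ)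
    (hfstar_cont : ContinuousOn fstar X)
    (hfix : ∀ x ∈ X, sinkhornKnopp γ c α β fstar x = fstar x)
    (f : ℕ → EuclideanSpace ℝ (Fin q) → ℝ)
    (hf0_cont : ContinuousOn (f 0) X)
    (hrec : ∀ t, ∀ x ∈ X, f (t + 1) x = sinkhornKnopp γ c α β (f t) x) :
    ∀ t : ℕ, oscOn X (fun x => f t x - fstar x) ≤
      lam ^ (2 * t) * oscOn X (fun x => f 0 x - fstar x) := by
  obtain ⟨x₀, hx₀⟩ := nonempty_of_compl_null hα
  have hMc : 0 ≤ Mc := (hc_bd x₀ hx₀ x₀ hx₀).1.trans (hc_bd x₀ hx₀ x₀ hx₀).2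
  have hc_nonneg : ∀ x ∈ X, ∀ y ∈ X, 0 ≤ c x y := fun x hx y hy => (hc_bd x hx y hy).1
  have hlam0 : 0 ≤ lam := by
    have : 1 ≤ Real.exp (Mc / γ) := Real.one_le_exp (by positivity)
    rw [hlam]
    exact div_nonneg (by linarith) (by linarith)
  have hf_cont : ∀ t, ContinuousOn (f t) X := by
    intro t
    induction t with
    | zero => exact hf0_cont
    | succ t ih =>
      exact (continuousOn_sinkhornMap hX hγ hc_cont hc_nonneg hβ
        (continuousOn_sinkhornMap hX hγ hc_cont hc_nonneg hα ih)).congr (hrec t)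
  intro t
  induction t with
  | zero => simp
  | succ t ih =>
    calc oscOn X (fun x => f (t + 1) x - fstar x)
        = oscOn X (fun x => sinkhornKnopp γ c α β (f t) x - sinkhornKnopp γ c α β fstar x) :=
          oscOn_congr fun x hx => by simp only [hrec t x hx, hfix x hx]
      _ ≤ lam * oscOn X (fun x => sinkhornMap γ c (f t) α x - sinkhornMap γ c fstar α x) := by
          rw [hlam]
          exact oscOn_sinkhornMap_sub_le hX hγ hc_cont hc_bd hMc hβ
            (continuousOn_sinkhornMap hX hγ hc_cont hc_nonneg hα (hf_cont t))
            (continuousOn_sinkhornMap hX hγ hc_cont hc_nonneg hα hfstar_cont)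
      _ ≤ lam * (lam * oscOn X (fun x => f t x - fstar x)) := by
          refine mul_le_mul_of_nonneg_left ?_ hlam0
          rw [hlam]
          exact oscOn_sinkhornMap_sub_le hX hγ hc_cont hc_bd hMc hα (hf_cont t) hfstar_cont
      _ ≤ lam * (lam * (lam ^ (2 * t) * oscOn X (fun x => f 0 x - fstar x))) := by
          gcongr
      _ = lam ^ (2 * (t + 1)) * oscOn X (fun x => f 0 x - fstar x) := by ring
end

section
/- Let X ⊆ ℝ^q be compact, γ > 0, and c : X × X → ℝ continuous with 0 ≤ c(x,y) ≤ M_c and G_c-Lipschitz in its first variable. Let f : X → ℝ be continuous with ‖f‖∞ ≤ M_c and G_f-Lipschitz. Then for any two probability measures α, α' on X, ‖A(f, α) − A(f, α')‖∞ ≤ γ · exp(2M_c/γ) · max{ exp(M_c/γ), exp(M_c/γ)(G_c + G_f)/γ } · d_bl(α, α'). -/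
open MeasureTheory

/-- The bounded-Lipschitz metric on measures supported in `X`:
`d_bl(α, α') = sup { |∫ ξ dα - ∫ ξ dα'| : |ξ| ≤ 1 and ξ 1-Lipschitz on X }`. -/
noncomputable def dblOn {q : ℕ} (X : Set (EuclideanSpace ℝ (Fin q)))
    (α α' : Measure (EuclideanSpace ℝ (Fin q))) : ℝ :=
  sSup {r : ℝ | ∃ ξ : EuclideanSpace ℝ (Fin q) → ℝ,
    (∀ x ∈ X, |ξ x| ≤ 1) ∧ LipschitzOnWith 1 ξ X ∧
    r = |(∫ x, ξ x ∂α) - (∫ x, ξ x ∂α')|}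

/-- `Real.exp` is `exp b`-Lipschitz on `(-∞, b]`. -/
lemma abs_exp_sub_exp_le {u v b : ℝ} (hu : u ≤ b) (hv : v ≤ b) :
    |Real.exp u - Real.exp v| ≤ Real.exp b * |u - v| := by
  wlog h : v ≤ u generalizing u v
  · rw [abs_sub_comm, abs_sub_comm u v]
    exact this hv hu (le_of_not_ge h)
  rw [abs_of_nonneg (sub_nonneg.2 (Real.exp_le_exp.2 h)), abs_of_nonneg (sub_nonneg.2 h)]
  have h1 : Real.exp v = Real.exp u * Real.exp (v - u) := by
    rw [← Real.exp_add]
    ring_nf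
  have h2 := Real.add_one_le_exp (v - u)
  calc Real.exp u - Real.exp v = Real.exp u * (1 - Real.exp (v - u)) := by rw [h1]; ring
    _ ≤ Real.exp u * (u - v) :=
      mul_le_mul_of_nonneg_left (by linarith) (Real.exp_pos u).le
    _ ≤ Real.exp b * (u - v) := by
      have := sub_nonneg.2 h
      gcongr

/-- `Real.log` is `m⁻¹`-Lipschitz on `[m, ∞)`. -/
lemma abs_log_sub_log_le {a b m : ℝ} (hm : 0 < m) (ha : m ≤ a) (hb : m ≤ b) :
    |Real.log a - Real.log b| ≤ m⁻¹ * |a - b| := by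
  wlog h : b ≤ a generalizing a b
  · rw [abs_sub_comm, abs_sub_comm a b]
    exact this hb ha (le_of_not_ge h)
  have hb0 : 0 < b := hm.trans_le hb
  have ha0 : 0 < a := hm.trans_le ha
  rw [abs_of_nonneg (sub_nonneg.2 (Real.log_le_log hb0 h)), abs_of_nonneg (sub_nonneg.2 h),
    ← Real.log_div ha0.ne' hb0.ne']
  calc Real.log (a / b) ≤ a / b - 1 := Real.log_le_sub_one_of_pos (by positivity)
    _ = b⁻¹ * (a - b) := by field_simp
    _ ≤ m⁻¹ * (a - b) := by
      have := sub_nonneg.2 h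
      gcongr

/-- A test function bounded by `K` and `K`-Lipschitz on `X` has integrals against `α` and `α'`
that differ by at most `K * dblOn X α α'`. -/
lemma abs_integral_sub_le_mul_dblOn {q : ℕ} {X : Set (EuclideanSpace ℝ (Fin q))}
    {α α' : Measure (EuclideanSpace ℝ (Fin q))}
    [IsProbabilityMeasure α] [IsProbabilityMeasure α']
    (hα : ∀ᵐ x ∂α, x ∈ X) (hα' : ∀ᵐ x ∂α', x ∈ X)
    {g : EuclideanSpace ℝ (Fin q) → ℝ} {K : ℝ} (hK : 0 < K)
    (hg_bd : ∀ x ∈ X, |g x| ≤ K)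
    (hg_lip : ∀ x ∈ X, ∀ x' ∈ X, |g x - g x'| ≤ K * ‖x - x'‖) :
    |(∫ x, g x ∂α) - ∫ x, g x ∂α'| ≤ K * dblOn X α α' := by
  have hbdd : BddAbove {r : ℝ | ∃ ξ : EuclideanSpace ℝ (Fin q) → ℝ,
      (∀ x ∈ X, |ξ x| ≤ 1) ∧ LipschitzOnWith 1 ξ X ∧
      r = |(∫ x, ξ x ∂α) - (∫ x, ξ x ∂α')|} := by
    refine ⟨1 + 1, ?_⟩
    rintro r ⟨ξ, hξ, -, rfl⟩
    have h1 : ‖∫ x, ξ x ∂α‖ ≤ 1 * α.real Set.univ :=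
      norm_integral_le_of_norm_le_const (hα.mono hξ)
    have h2 : ‖∫ x, ξ x ∂α'‖ ≤ 1 * α'.real Set.univ :=
      norm_integral_le_of_norm_le_const (hα'.mono hξ)
    simp only [probReal_univ, mul_one, Real.norm_eq_abs] at h1 h2
    exact (abs_sub _ _).trans (add_le_add h1 h2)
  have hmem : |(∫ x, K⁻¹ * g x ∂α) - ∫ x, K⁻¹ * g x ∂α'| ≤ dblOn X α α' := by
    refine le_csSup hbdd ⟨fun x => K⁻¹ * g x, fun x hx => ?_, ?_, rfl⟩
    · rw [abs_mul, abs_of_pos (inv_pos.2 hK), inv_mul_le_iff₀ hK, mul_one]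
      exact hg_bd x hx
    · refine LipschitzOnWith.of_dist_le_mul fun x hx x' hx' => ?_
      rw [Real.dist_eq, dist_eq_norm, ← mul_sub, abs_mul, abs_of_pos (inv_pos.2 hK),
        inv_mul_le_iff₀ hK, NNReal.coe_one, one_mul]
      exact hg_lip x hx x' hx'
  rwa [integral_const_mul, integral_const_mul, ← mul_sub, abs_mul, abs_of_pos (inv_pos.2 hK),
    inv_mul_le_iff₀ hK] at hmem

/-- A function continuous on a compact set carrying the probability measure `μ` and bounded below
there by `m` has integral at least `m`. -/
lemma le_integral_of_continuousOn {E : Type*} [TopologicalSpace E] [T2Space E]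
    [MeasurableSpace E] [OpensMeasurableSpace E] {X : Set E} (hX : IsCompact X)
    {μ : Measure E} [IsProbabilityMeasure μ] (hμ : ∀ᵐ x ∂μ, x ∈ X) {g : E → ℝ}
    (hg : ContinuousOn g X) {m : ℝ} (hm : ∀ x ∈ X, m ≤ g x) : m ≤ ∫ x, g x ∂μ := by
  have hint : Integrable g μ := by
    have h := hg.integrableOn_compact (μ := μ) hX
    rwa [IntegrableOn, Measure.restrict_eq_self_of_ae_mem hμ] at h
  have h := integral_mono_ae (integrable_const m) hint (hμ.mono hm)
  simpa using h

/-- **Lipschitz continuity of the Sinkhorn mapping in the measure argument**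
(with respect to the bounded-Lipschitz metric), with the explicit constant
`γ exp(2M_c/γ) max{exp(M_c/γ), exp(M_c/γ)(G_c + G_f)/γ}`. -/
theorem sinkhornMap_lipschitz_in_measure
    {q : ℕ} (X : Set (EuclideanSpace ℝ (Fin q))) (hX : IsCompact X)
    (γ : ℝ) (hγ : 0 < γ) (Mc Gc Gf : ℝ)
    (c : EuclideanSpace ℝ (Fin q) → EuclideanSpace ℝ (Fin q) → ℝ)
    (hc_cont : ContinuousOn (fun p : EuclideanSpace ℝ (Fin q) × EuclideanSpace ℝ (Fin q) =>
      c p.1 p.2) (X ×ˢ X))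
    (hc_bd : ∀ x ∈ X, ∀ y ∈ X, 0 ≤ c x y ∧ c x y ≤ Mc)
    (hc_lip1 : ∀ y ∈ X, ∀ x ∈ X, ∀ x' ∈ X, |c x y - c x' y| ≤ Gc * ‖x - x'‖)
    (f : EuclideanSpace ℝ (Fin q) → ℝ)
    (hf_cont : ContinuousOn f X)
    (hf_bd : ∀ x ∈ X, |f x| ≤ Mc)
    (hf_lip : ∀ x ∈ X, ∀ x' ∈ X, |f x - f x'| ≤ Gf * ‖x - x'‖)
    (α α' : Measure (EuclideanSpace ℝ (Fin q)))
    [IsProbabilityMeasure α] [IsProbabilityMeasure α']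
    (hα : α Xᶜ = 0) (hα' : α' Xᶜ = 0) :
    ∀ y ∈ X, |sinkhornMap γ c f α y - sinkhornMap γ c f α' y| ≤
      γ * Real.exp (2 * Mc / γ) *
        max (Real.exp (Mc / γ)) (Real.exp (Mc / γ) * (Gc + Gf) / γ) *
        dblOn X α α' := by
  intro y hy
  have hαX : ∀ᵐ x ∂α, x ∈ X := hα
  have hαX' : ∀ᵐ x ∂α', x ∈ X := hα'
  set g : EuclideanSpace ℝ (Fin q) → ℝ := fun x => Real.exp ((f x - c x y) / γ) with hg
  set K := max (Real.exp (Mc / γ)) (Real.exp (Mc / γ) * (Gc + Gf) / γ) with hK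
  have hK0 : 0 < K := (Real.exp_pos _).trans_le (le_max_left _ _)
  have hg_cont : ContinuousOn g X := by
    have hc : ContinuousOn (fun x => c x y) X :=
      hc_cont.comp (f := fun x => (x, y)) (by fun_prop) fun x hx => ⟨hx, hy⟩
    exact ((hf_cont.sub hc).div_const γ).rexp
  have h_le : ∀ x ∈ X, (f x - c x y) / γ ≤ Mc / γ := fun x hx => by
    have := (abs_le.1 (hf_bd x hx)).2
    have := (hc_bd x hx y hy).1
    gcongr
    linarith
  have hg_lower : ∀ x ∈ X, Real.exp (-(2 * Mc / γ)) ≤ g x := fun x hx => by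
    have := (abs_le.1 (hf_bd x hx)).1
    have := (hc_bd x hx y hy).2
    rw [hg, ← neg_div]
    dsimp only
    gcongr
    linarith
  have hg_lip : ∀ x ∈ X, ∀ x' ∈ X, |g x - g x'| ≤ K * ‖x - x'‖ := fun x hx x' hx' => by
    have hdiff : |(f x - c x y) - (f x' - c x' y)| ≤ (Gc + Gf) * ‖x - x'‖ := by
      have h1 := hf_lip x hx x' hx'
      have h2 := hc_lip1 y hy x hx x' hx'
      calc |(f x - c x y) - (f x' - c x' y)| = |(f x - f x') - (c x y - c x' y)| := by ring_nf
        _ ≤ |f x - f x'| + |c x y - c x' y| := abs_sub _ _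
        _ ≤ (Gc + Gf) * ‖x - x'‖ := by linarith
    calc |g x - g x'|
        ≤ Real.exp (Mc / γ) * |(f x - c x y) / γ - (f x' - c x' y) / γ| :=
          abs_exp_sub_exp_le (h_le x hx) (h_le x' hx')
      _ = Real.exp (Mc / γ) * (|(f x - c x y) - (f x' - c x' y)| / γ) := by
          rw [← sub_div, abs_div, abs_of_pos hγ]
      _ ≤ Real.exp (Mc / γ) * ((Gc + Gf) * ‖x - x'‖ / γ) := by gcongr
      _ = Real.exp (Mc / γ) * (Gc + Gf) / γ * ‖x - x'‖ := by ring
      _ ≤ K * ‖x - x'‖ := by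
          gcongr
          exact le_max_right _ _
  have hg_bd : ∀ x ∈ X, |g x| ≤ K := fun x hx => by
    rw [abs_of_pos (Real.exp_pos _)]
    exact (Real.exp_le_exp.2 (h_le x hx)).trans (le_max_left _ _)
  have hlog := abs_log_sub_log_le (Real.exp_pos _)
    (le_integral_of_continuousOn hX hαX hg_cont hg_lower)
    (le_integral_of_continuousOn hX hαX' hg_cont hg_lower)
  rw [Real.exp_neg, inv_inv] at hlog
  calc |sinkhornMap γ c f α y - sinkhornMap γ c f α' y|
      = γ * |Real.log (∫ x, g x ∂α) - Real.log (∫ x, g x ∂α')| := by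
        rw [sinkhornMap, sinkhornMap, ← mul_sub, abs_mul, abs_neg, abs_of_pos hγ]
    _ ≤ γ * (Real.exp (2 * Mc / γ) * (K * dblOn X α α')) := by
        gcongr
        refine hlog.trans ?_
        gcongr
        exact abs_integral_sub_le_mul_dblOn hαX hαX' hK0 hg_bd hg_lip
    _ = γ * Real.exp (2 * Mc / γ) * K * dblOn X α α' := by ring
end
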